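/- arXiv:1809.10140 — 2 statements merged into one kernel-verified Lean document; each statement's English description precedes it below -/
import Mathlib

section
/- For x > 1 with log x ≠ 0, the principal value logarithmic integral satisfies Li(x) = γ + log(log x) + Σ_{m=1}^∞ (log x)^m/(m! · m), where γ is Euler's constant and the series converges absolutely. -/
open Filter MeasureTheory

/-- The principal value logarithmic integral `Li(x) = p.v. ∫_0^x dt / log t`. -/
noncomputable def Li (x : ℝ) : ℝ :=
  if x < 1 then ∫ t in (0:ℝ)..x, 1 / Real.log t
  else limUnder (nhdsWithin 0 (Set.Ioi 0)) fun ε : ℝ =>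
    (∫ t in (0:ℝ)..(1 - ε), 1 / Real.log t) + ∫ t in (1 + ε)..x, 1 / Real.log t

open Topology

/-- The entire function `∑ u^(n+1)/((n+1)!(n+1))`. -/
noncomputable def SS (u : ℝ) : ℝ := ∑' n : ℕ, u ^ (n + 1) / ((n + 1).factorial * ((n + 1 : ℕ) : ℝ))

lemma term_hasDeriv (n : ℕ) (y : ℝ) :
    HasDerivAt (fun u : ℝ => u ^ (n + 1) / ((n + 1).factorial * ((n + 1 : ℕ) : ℝ)))
      (y ^ n / (n + 1).factorial) y := by
  have h := (hasDerivAt_pow (n + 1) y).div_const ((n + 1).factorial * ((n + 1 : ℕ) : ℝ))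
  refine h.congr_deriv ?_
  have h1 : ((n + 1).factorial : ℝ) ≠ 0 := by positivity
  have h2 : ((n + 1 : ℕ) : ℝ) ≠ 0 := by positivity
  rw [Nat.add_sub_cancel]
  field_simp

lemma fact_le (n : ℕ) : ((n).factorial : ℝ) ≤ (n + 1).factorial := by
  exact_mod_cast Nat.factorial_le (Nat.le_succ n)

lemma term_summable (u : ℝ) :
    Summable (fun n : ℕ => u ^ (n + 1) / ((n + 1).factorial * ((n + 1 : ℕ) : ℝ))) := by
  have h := (summable_nat_add_iff 1).2 (Real.summable_pow_div_factorial |u|)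
  refine Summable.of_norm_bounded h (fun n => ?_)
  rw [Real.norm_eq_abs, abs_div, abs_pow]
  have h2 : (1 : ℝ) ≤ ((n + 1 : ℕ) : ℝ) := by exact_mod_cast Nat.le_add_left 1 n
  have h1 : (0 : ℝ) < (n + 1).factorial := by positivity
  have h3 : (0 : ℝ) < (n + 1).factorial * ((n + 1 : ℕ) : ℝ) := by positivity
  rw [abs_of_pos h3]
  apply div_le_div_of_nonneg_left (pow_nonneg (abs_nonneg u) _) h1
  nlinarith

lemma SS_hasDeriv (y : ℝ) :
    HasDerivAt SS (∑' n : ℕ, y ^ n / (n + 1).factorial) y := by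
  refine hasDerivAt_tsum_of_isPreconnected (t := Metric.ball 0 (|y| + 1)) (y₀ := y)
    (u := fun n : ℕ => (|y| + 1) ^ n / n.factorial)
    (Real.summable_pow_div_factorial (|y| + 1)) Metric.isOpen_ball
    (convex_ball _ _).isPreconnected (fun n z _ => term_hasDeriv n z) ?_ ?_ (term_summable y) ?_
  · intro n z hz
    rw [mem_ball_zero_iff, Real.norm_eq_abs] at hz
    rw [Real.norm_eq_abs, abs_div, abs_pow, Nat.abs_cast]
    have := fact_le n
    have h1 : (0 : ℝ) < n.factorial := by positivity
    gcongr
  · simp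
  · simp

lemma SS_deriv_eq (y : ℝ) : y * (∑' n : ℕ, y ^ n / (n + 1).factorial) = Real.exp y - 1 := by
  rw [← tsum_mul_left, Real.exp_eq_exp_ℝ, NormedSpace.exp_eq_tsum_div]
  beta_reduce
  rw [(Real.summable_pow_div_factorial y).tsum_eq_zero_add]
  simp only [pow_zero, Nat.factorial_zero, Nat.cast_one, div_one, add_sub_cancel_left]
  congr 1
  ext n
  ring

lemma SS_hasDeriv' {y : ℝ} (hy : y ≠ 0) : HasDerivAt SS ((Real.exp y - 1) / y) y := by
  have := SS_hasDeriv y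
  rwa [show (Real.exp y - 1) / y = ∑' n : ℕ, y ^ n / (n + 1).factorial by
    rw [← SS_deriv_eq]; field_simp]

lemma SS_cont : Continuous SS :=
  continuous_iff_continuousAt.2 fun y => (SS_hasDeriv y).continuousAt

lemma SS_zero : SS 0 = 0 := by simp [SS]

lemma int_log_exp :
    ∫ t in Set.Ioi (0 : ℝ), Real.log t * Real.exp (-t) = -Real.eulerMascheroniConstant := by
  have h := Complex.hasDerivAt_GammaIntegral (s := 1) (by simp)
  have h2 : HasDerivAt Complex.Gamma
      (∫ t : ℝ in Set.Ioi 0, (t : ℂ) ^ ((1 : ℂ) - 1) * (Real.log t * Real.exp (-t))) 1 := by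
    refine h.congr_of_eventuallyEq ?_
    have : IsOpen {s : ℂ | 0 < s.re} := isOpen_lt continuous_const Complex.continuous_re
    filter_upwards [this.mem_nhds (by simp : (1 : ℂ) ∈ {s : ℂ | 0 < s.re})] with a ha
    exact Complex.Gamma_eq_integral ha
  have h3 := h2.unique Complex.hasDerivAt_Gamma_one
  have h4 : ∫ t : ℝ in Set.Ioi 0, (t : ℂ) ^ ((1 : ℂ) - 1) * (Real.log t * Real.exp (-t))
      = ((∫ t in Set.Ioi (0 : ℝ), Real.log t * Real.exp (-t) : ℝ) : ℂ) := by
    rw [← integral_complex_ofReal]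
    congr 1
    ext t
    simp
  rw [h4] at h3
  exact_mod_cast h3

lemma integrable_log_exp :
    IntegrableOn (fun t => Real.log t * Real.exp (-t)) (Set.Ioi (0 : ℝ)) := by
  by_contra hc
  have h1 := int_log_exp
  rw [integral_undef hc] at h1
  have := Real.one_half_lt_eulerMascheroniConstant
  linarith

/-- Key limit. -/
lemma tendsto_G : Tendsto (fun v : ℝ => Real.log v + SS (-v)) atTop
    (𝓝 (-Real.eulerMascheroniConstant)) := by
  have h1 := intervalIntegral_tendsto_integral_Ioi (0 : ℝ) integrable_log_exp tendsto_id
  rw [int_log_exp] at h1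
  set P : ℝ → ℝ := fun t => (1 - Real.exp (-t)) * Real.log t + SS (-t) with hP
  have hder : ∀ t : ℝ, 0 < t → HasDerivAt P (Real.log t * Real.exp (-t)) t := by
    intro t ht
    have e1 : HasDerivAt (fun t : ℝ => Real.exp (-t)) (Real.exp (-t) * (-1)) t :=
      (hasDerivAt_neg t).exp
    have e2 : HasDerivAt (fun t : ℝ => SS (-t)) ((Real.exp (-t) - 1) / (-t) * (-1)) t :=
      (SS_hasDeriv' (neg_ne_zero.2 ht.ne')).comp t (hasDerivAt_neg t)
    have e3 := ((e1.const_sub 1).mul (Real.hasDerivAt_log ht.ne')).add e2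
    refine e3.congr_deriv ?_
    field_simp
    ring
  have h0 : Tendsto P (𝓝[>] 0) (𝓝 0) := by
    have a1 : Tendsto (fun t : ℝ => (1 - Real.exp (-t)) * Real.log t) (𝓝[>] 0) (𝓝 0) := by
      have hl : Tendsto (fun t : ℝ => |t * Real.log t|) (𝓝[>] 0) (𝓝 0) := by
        have := (Real.continuous_mul_log.abs.tendsto 0).mono_left
          (nhdsWithin_le_nhds (s := Set.Ioi (0 : ℝ)))
        simpa using this
      refine squeeze_zero_norm' ?_ hl
      filter_upwards [self_mem_nhdsWithin] with t ht
      have ht : 0 < t := ht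
      rw [Real.norm_eq_abs, abs_mul, abs_mul]
      have b1 := Real.add_one_le_exp (-t)
      have b2 : Real.exp (-t) ≤ 1 := Real.exp_le_one_iff.2 (by linarith)
      rw [abs_of_pos ht, abs_of_nonneg (by linarith)]
      gcongr
      linarith
    have a2 : Tendsto (fun t : ℝ => SS (-t)) (𝓝[>] 0) (𝓝 0) := by
      have := ((SS_cont.comp continuous_neg).tendsto 0).mono_left
        (nhdsWithin_le_nhds (s := Set.Ioi (0 : ℝ)))
      simpa [SS_zero, Function.comp_def] using this
    simpa using a1.add a2
  have hPint : ∀ b : ℝ, 0 < b → ∫ t in (0 : ℝ)..b, Real.log t * Real.exp (-t) = P b := by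
    intro b hb
    have := intervalIntegral.integral_eq_sub_of_hasDerivAt_of_tendsto hb
      (fun t ht => hder t ht.1)
      ((intervalIntegrable_iff_integrableOn_Ioc_of_le hb.le).2
        (integrable_log_exp.mono_set Set.Ioc_subset_Ioi_self))
      h0 ((hder b hb).continuousAt.tendsto.mono_left nhdsWithin_le_nhds)
    simpa using this
  have hE : Tendsto (fun v : ℝ => Real.exp (-v) * Real.log v) atTop (𝓝 0) := by
    have := Real.tendsto_pow_mul_exp_neg_atTop_nhds_zero 1
    refine squeeze_zero' ?_ ?_ this
    · filter_upwards [eventually_ge_atTop 1] with v hv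
      exact mul_nonneg (Real.exp_pos _).le (Real.log_nonneg hv)
    · filter_upwards [eventually_ge_atTop 1] with v hv
      rw [pow_one, mul_comm]
      gcongr
      linarith [Real.log_le_sub_one_of_pos (by linarith : 0 < v)]
  have h5 := h1.add hE
  rw [add_zero] at h5
  refine h5.congr' ?_
  filter_upwards [eventually_gt_atTop 0] with v hv
  simp only [id]
  rw [hPint v hv, hP]
  ring

/-- The antiderivative of `1 / log`. -/
noncomputable def FF (t : ℝ) : ℝ := Real.log (Real.log t) + SS (Real.log t)

lemma FF_hasDeriv {t : ℝ} (ht : 0 < t) (ht1 : t ≠ 1) : HasDerivAt FF (1 / Real.log t) t := by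
  have hl : Real.log t ≠ 0 := Real.log_ne_zero_of_pos_of_ne_one ht ht1
  have h1 := Real.hasDerivAt_log ht.ne'
  have h2 := ((SS_hasDeriv' hl).comp t h1)
  have h3 := (h1.log hl).add h2
  refine h3.congr_deriv ?_
  rw [Real.exp_log ht]
  field_simp
  ring

lemma FF_zero : Tendsto FF (𝓝[>] 0) (𝓝 (-Real.eulerMascheroniConstant)) := by
  have h := tendsto_G.comp (tendsto_neg_atBot_atTop.comp Real.tendsto_log_nhdsGT_zero)
  refine h.congr fun t => ?_
  simp [FF]

lemma invlog_cont {t : ℝ} (h0 : 0 ≤ t) (ht1 : t ≠ 1) :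
    ContinuousAt (fun t => 1 / Real.log t) t := by
  rcases h0.eq_or_lt with rfl | h
  · rw [continuousAt_iff_punctured_nhds]
    simp only [one_div, Real.log_zero, inv_zero]
    exact tendsto_inv_atBot_zero.comp Real.tendsto_log_nhdsNE_zero
  · exact continuousAt_const.div (Real.continuousAt_log h.ne')
      (Real.log_ne_zero_of_pos_of_ne_one h ht1)

lemma int_left {b : ℝ} (hb : 0 < b) (hb1 : b < 1) :
    ∫ t in (0:ℝ)..b, 1 / Real.log t = FF b + Real.eulerMascheroniConstant := by
  rw [intervalIntegral.integral_eq_sub_of_hasDerivAt_of_tendsto hb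
      (fun t ht => FF_hasDeriv ht.1 (ht.2.trans hb1).ne) ?_ FF_zero
      ((FF_hasDeriv hb hb1.ne).continuousAt.tendsto.mono_left nhdsWithin_le_nhds)]
  · ring
  · apply ContinuousOn.intervalIntegrable
    intro t ht
    rw [Set.uIcc_of_le hb.le] at ht
    exact (invlog_cont ht.1 (ht.2.trans_lt hb1).ne).continuousWithinAt

lemma int_right {a x : ℝ} (ha : 1 < a) (hx : 1 < x) :
    ∫ t in a..x, 1 / Real.log t = FF x - FF a := by
  have key : ∀ t ∈ Set.uIcc a x, 1 < t := fun t ht => (lt_min ha hx).trans_le ht.1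
  refine intervalIntegral.integral_eq_sub_of_hasDerivAt
    (fun t ht => FF_hasDeriv (by linarith [key t ht]) (key t ht).ne') ?_
  apply ContinuousOn.intervalIntegrable
  intro t ht
  exact (invlog_cont (by linarith [key t ht]) (key t ht).ne').continuousWithinAt

lemma log_ratio (c : ℝ) (hc : c ≠ 0) :
    Tendsto (fun ε : ℝ => Real.log (Real.log (1 + c * ε) / ε)) (𝓝[>] 0) (𝓝 (Real.log c)) := by
  have h : HasDerivAt (fun ε : ℝ => Real.log (1 + c * ε)) c 0 := by
    have h1 : HasDerivAt (fun ε : ℝ => 1 + c * ε) c 0 := by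
      simpa using ((hasDerivAt_id (0 : ℝ)).const_mul c).const_add 1
    simpa using h1.log (by simp)
  have h2 := (hasDerivAt_iff_tendsto_slope.1 h).mono_left
    (nhdsWithin_mono 0 (fun y (hy : 0 < y) => hy.ne') : 𝓝[>] (0:ℝ) ≤ 𝓝[≠] 0)
  refine (h2.log hc).congr fun ε => ?_
  simp [slope_def_field]

lemma FF_diff : Tendsto (fun ε : ℝ => FF (1 - ε) - FF (1 + ε)) (𝓝[>] 0) (𝓝 0) := by
  have h1 := (log_ratio (-1) (by norm_num)).sub (log_ratio 1 one_ne_zero)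
  have h2 : Tendsto (fun ε : ℝ => SS (Real.log (1 - ε)) - SS (Real.log (1 + ε)))
      (𝓝[>] 0) (𝓝 0) := by
    have : ContinuousAt (fun ε : ℝ => SS (Real.log (1 - ε)) - SS (Real.log (1 + ε))) 0 := by
      have a1 : ContinuousAt (fun ε : ℝ => Real.log (1 - ε)) 0 :=
        ContinuousAt.log (by fun_prop) (by simp)
      have a2 : ContinuousAt (fun ε : ℝ => Real.log (1 + ε)) 0 :=
        ContinuousAt.log (by fun_prop) (by simp)
      exact (SS_cont.continuousAt.comp a1).sub (SS_cont.continuousAt.comp a2)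
    simpa using this.tendsto.mono_left (nhdsWithin_le_nhds (s := Set.Ioi (0 : ℝ)))
  have h3 := h1.add h2
  simp only [Real.log_neg_eq_log, sub_self, add_zero] at h3
  refine h3.congr' ?_
  filter_upwards [Ioo_mem_nhdsGT (zero_lt_one' ℝ)] with ε hε
  have e0 := hε.1
  have l1 : Real.log (1 + -1 * ε) ≠ 0 :=
    Real.log_ne_zero_of_pos_of_ne_one (by linarith [hε.2]) (by linarith)
  have l2 : Real.log (1 + 1 * ε) ≠ 0 :=
    Real.log_ne_zero_of_pos_of_ne_one (by linarith [hε.2]) (by linarith)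
  rw [Real.log_div l1 e0.ne', Real.log_div l2 e0.ne', FF, FF,
    show 1 + -1 * ε = 1 - ε by ring, one_mul]
  ring

/-- **The Ramanujan/Soldner series expansion of the logarithmic integral:** for `x > 1`,
`Li(x) = γ + log(log x) + ∑_{m ≥ 1} (log x)^m / (m! · m)`, the series converging
absolutely. -/
theorem Li_series_expansion (x : ℝ) (hx : 1 < x) :
    Li x = Real.eulerMascheroniConstant + Real.log (Real.log x)
        + ∑' m : ℕ, (if 1 ≤ m then (Real.log x) ^ m / (Nat.factorial m * m) else 0)
    ∧ Summable (fun m : ℕ =>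
        |if 1 ≤ m then (Real.log x) ^ m / (Nat.factorial m * m) else 0|) := by
  have hs : Summable (fun m : ℕ =>
      if 1 ≤ m then (Real.log x) ^ m / (Nat.factorial m * (m : ℝ)) else 0) := by
    rw [← summable_nat_add_iff 1]
    simpa using term_summable (Real.log x)
  refine ⟨?_, hs.abs⟩
  have ht : ∑' m : ℕ, (if 1 ≤ m then (Real.log x) ^ m / (Nat.factorial m * (m : ℝ)) else 0)
      = SS (Real.log x) := by
    rw [hs.tsum_eq_zero_add]
    simp [SS]
  rw [ht, Li, if_neg (by linarith)]
  apply Tendsto.limUnder_eq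
  have h := FF_diff.add_const (FF x + Real.eulerMascheroniConstant)
  rw [zero_add, show FF x + Real.eulerMascheroniConstant = Real.eulerMascheroniConstant +
    Real.log (Real.log x) + SS (Real.log x) by rw [FF]; ring] at h
  refine h.congr' ?_
  filter_upwards [Ioo_mem_nhdsGT (zero_lt_one' ℝ)] with ε hε
  rw [int_left (by linarith [hε.2]) (by linarith [hε.1]), int_right (by linarith [hε.1]) hx, FF, FF,
    FF]
  ring
end

section
/- Suppose Ψ(x) = Σ_{j ∈ J} x^{s_j}/s_j + E(x) with J finite, s_j ∈ (1/2, 1], and two regularity statements hold: (a) E(x) ≪ x^α (log x)^β with 1/2 ≤ α < min_j s_j, and (b) the partial sums S(x) = Σ over prime powers defining Ψ. Then for real s with Re s > α and s ≠ s_j, the integral ∫_2^∞ E(t) t^{−s−1} dt converges absolutely, and consequently Σ over the given arithmetic weights x^{s_j − s} terms: the limit lim_{x→∞} [ Σ_{N(p)^k ≤ x} a(p,k) N(p)^{−ks}/k − Σ_{j} Li(x^{s_j − s}) ] exists, where Ψ(x) = Σ_{N(p)^k ≤ x} a(p,k) log N(p). -/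
open Filter MeasureTheory

lemma invlog_ii_lt {a b : ℝ} (ha : 0 ≤ a) (hab : a ≤ b) (hb : b < 1) :
    IntervalIntegrable (fun t : ℝ => 1 / Real.log t) volume a b := by
  rw [intervalIntegrable_iff, Set.uIoc_of_le hab]
  refine Measure.integrableOn_of_bounded (M := 1 / (-Real.log b)) (by simp) ?_ ?_
  · exact (measurable_const.div Real.measurable_log).aestronglyMeasurable
  · refine (ae_restrict_iff' measurableSet_Ioc).2 (Eventually.of_forall fun t ht => ?_)
    have ht0 : 0 < t := lt_of_le_of_lt ha ht.1
    have h1 : Real.log t ≤ Real.log b := Real.log_le_log ht0 ht.2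
    have h2 : Real.log b < 0 := Real.log_neg (lt_of_lt_of_le ht0 ht.2) hb
    rw [Real.norm_eq_abs, abs_div, abs_one, abs_of_neg (by linarith)]
    exact one_div_le_one_div_of_le (by linarith) (by linarith)

lemma invlog_ii_gt {a b : ℝ} (ha : 1 < a) (hb : 1 < b) :
    IntervalIntegrable (fun t : ℝ => 1 / Real.log t) volume a b := by
  apply ContinuousOn.intervalIntegrable
  intro t ht
  have h1 : 1 < t := lt_of_lt_of_le (lt_min ha hb) ht.1
  have : Real.log t ≠ 0 := (Real.log_pos h1).ne'
  have h0 : t ≠ 0 := by linarith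
  exact (continuousAt_const.div (Real.continuousAt_log h0) this).continuousWithinAt

lemma pv_bound {u : ℝ} (h0 : 0 < u) (h1 : u ≤ 1/2) :
    |1 / Real.log (1 - u) + 1 / Real.log (1 + u)| ≤ 2 := by
  have a1 : Real.log (1 + u) ≤ u := by
    have := Real.log_le_sub_one_of_pos (show 0 < 1 + u by linarith); linarith
  have a2 : u / (1 + u) ≤ Real.log (1 + u) := by
    have := Real.one_sub_inv_le_log_of_pos (show 0 < 1 + u by linarith)
    have e : 1 - (1 + u)⁻¹ = u / (1 + u) := by field_simp; ring
    linarith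
  have b1 : u ≤ - Real.log (1 - u) := by
    have := Real.log_le_sub_one_of_pos (show 0 < 1 - u by linarith); linarith
  have b2 : - Real.log (1 - u) ≤ u / (1 - u) := by
    have := Real.one_sub_inv_le_log_of_pos (show 0 < 1 - u by linarith)
    have h : 1 - u ≠ 0 := by linarith
    have e : 1 - (1 - u)⁻¹ = - (u / (1 - u)) := by field_simp; ring
    linarith
  have p : 0 < u / (1 + u) := by positivity
  have c1 := one_div_le_one_div_of_le (by linarith) a1
  have c2 := one_div_le_one_div_of_le p a2
  have c3 := one_div_le_one_div_of_le h0 b1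
  have c4 := one_div_le_one_div_of_le (by linarith) b2
  have e1 : 1 / (u / (1 + u)) = 1 / u + 1 := by field_simp
  have e2 : 1 / (u / (1 - u)) = 1 / u - 1 := by
    have h : 1 - u ≠ 0 := by linarith
    field_simp
  have e3 : 1 / (-Real.log (1 - u)) = - (1 / Real.log (1 - u)) := by
    rw [div_neg]
  rw [abs_le]; constructor <;> linarith

lemma pv_exists (y : ℝ) (hy : 1 < y) : ∃ L : ℝ, Tendsto (fun ε : ℝ =>
    (∫ t in (0:ℝ)..(1 - ε), 1 / Real.log t) + ∫ t in (1 + ε)..y, 1 / Real.log t)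
    (nhdsWithin 0 (Set.Ioi 0)) (nhds L) := by
  set h : ℝ → ℝ := fun u => 1 / Real.log (1 - u) + 1 / Real.log (1 + u) with hh
  have hint : IntegrableOn h (Set.uIcc 0 (1/2)) := by
    rw [Set.uIcc_of_le (by norm_num), integrableOn_Icc_iff_integrableOn_Ioc]
    refine Measure.integrableOn_of_bounded (M := 2) (by simp) ?_ ?_
    · apply Measurable.aestronglyMeasurable
      simp only [hh]; fun_prop
    · exact (ae_restrict_iff' measurableSet_Ioc).2
        (Eventually.of_forall fun t ht => pv_bound ht.1 ht.2)
  have hc := intervalIntegral.continuousOn_primitive_interval_left hint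
  have hc0 := hc 0 (by simp)
  have ht : Tendsto (fun ε : ℝ => ∫ t in ε..(1/2), h t) (nhdsWithin 0 (Set.Ioi 0))
      (nhds (∫ t in (0:ℝ)..(1/2), h t)) := by
    refine hc0.tendsto.mono_left ?_
    rw [Set.uIcc_of_le (by norm_num)]
    have : nhdsWithin (0:ℝ) (Set.Ioi 0) = nhdsWithin 0 (Set.Ioc 0 (1/2)) :=
      (nhdsWithin_Ioc_eq_nhdsGT (by norm_num)).symm
    rw [this]
    exact nhdsWithin_mono _ Set.Ioc_subset_Icc_self
  refine ⟨_, Tendsto.congr' ?_ (ht.const_add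
    ((∫ t in (0:ℝ)..(1/2), 1 / Real.log t) + ∫ t in (3/2)..y, 1 / Real.log t))⟩
  filter_upwards [Ioo_mem_nhdsGT (show (0:ℝ) < 1/2 by norm_num)] with ε hε
  obtain ⟨h1, h2⟩ := hε
  have A := intervalIntegral.integral_add_adjacent_intervals
    (invlog_ii_lt (a := 0) (b := 1/2) le_rfl (by norm_num) (by norm_num))
    (invlog_ii_lt (a := 1/2) (b := 1 - ε) (by norm_num) (by linarith) (by linarith))
  have B := intervalIntegral.integral_add_adjacent_intervals
    (invlog_ii_gt (a := 1 + ε) (b := 3/2) (by linarith) (by norm_num))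
    (invlog_ii_gt (a := 3/2) (b := y) (by norm_num) hy)
  have C := intervalIntegral.integral_comp_sub_left (a := ε) (b := 1/2)
    (fun t => 1 / Real.log t) 1
  have D := intervalIntegral.integral_comp_add_left (a := ε) (b := 1/2)
    (fun t => 1 / Real.log t) 1
  have I1 : IntervalIntegrable (fun u : ℝ => 1 / Real.log (1 - u)) volume ε (1/2) := by
    have := (invlog_ii_lt (a := 1/2) (b := 1 - ε) (by norm_num) (by linarith)
      (by linarith)).comp_sub_left 1
    have e : (1:ℝ) - 1/2 = 1/2 := by norm_num
    simp only [sub_sub_cancel, e] at this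
    exact this.symm
  have I2 : IntervalIntegrable (fun u : ℝ => 1 / Real.log (1 + u)) volume ε (1/2) := by
    have := (invlog_ii_gt (a := 1 + ε) (b := 3/2) (by linarith) (by norm_num)).comp_add_left 1
    have e : (3/2:ℝ) - 1 = 1/2 := by norm_num
    simp only [add_sub_cancel_left, e] at this
    exact this
  have F := intervalIntegral.integral_add I1 I2
  have e1 : (1:ℝ) - 1/2 = 1/2 := by norm_num
  have e2 : (1:ℝ) + 1/2 = 3/2 := by norm_num
  rw [e1] at C
  rw [e2] at D
  simp only [hh]
  linarith

lemma Li_sub_gt {y z : ℝ} (hy : 1 < y) (hz : 1 < z) :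
    Li z - Li y = ∫ t in y..z, 1 / Real.log t := by
  obtain ⟨L, hL⟩ := pv_exists y hy
  have hz' : Tendsto (fun ε : ℝ =>
    (∫ t in (0:ℝ)..(1 - ε), 1 / Real.log t) + ∫ t in (1 + ε)..z, 1 / Real.log t)
    (nhdsWithin 0 (Set.Ioi 0)) (nhds (L + ∫ t in y..z, 1 / Real.log t)) := by
    refine Tendsto.congr' ?_ (hL.add_const _)
    filter_upwards [self_mem_nhdsWithin] with ε hε
    have hε' : 0 < ε := hε
    have := intervalIntegral.integral_add_adjacent_intervals
      (invlog_ii_gt (a := 1 + ε) (b := y) (by linarith) hy) (invlog_ii_gt hy hz)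
    linarith
  rw [Li, Li, if_neg (by linarith), if_neg (by linarith), hL.limUnder_eq, hz'.limUnder_eq]
  ring

lemma Li_sub_lt {y z : ℝ} (hy : 0 < y) (hy1 : y < 1) (hz : 0 < z) (hz1 : z < 1) :
    Li z - Li y = ∫ t in y..z, 1 / Real.log t := by
  rw [Li, Li, if_pos hy1, if_pos hz1]
  exact intervalIntegral.integral_interval_sub_left (invlog_ii_lt le_rfl hz.le hz1)
    (invlog_ii_lt le_rfl hy.le hy1)

lemma Li_rpow {δ x : ℝ} (hδ : δ ≠ 0) (hx : 2 ≤ x) :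
    Li (x ^ δ) - Li (2 ^ δ) = ∫ t in (2:ℝ)..x, t ^ (δ - 1) / Real.log t := by
  have key : Li (x ^ δ) - Li (2 ^ δ) = ∫ t in ((2:ℝ) ^ δ)..(x ^ δ), 1 / Real.log t := by
    rcases lt_or_gt_of_ne hδ with h | h
    · exact Li_sub_lt (by positivity) (Real.rpow_lt_one_of_one_lt_of_neg (by norm_num) h)
        (by positivity) (Real.rpow_lt_one_of_one_lt_of_neg (by linarith) h)
    · exact Li_sub_gt (Real.one_lt_rpow (by norm_num) h) (Real.one_lt_rpow (by linarith) h)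
  have hpos : ∀ t ∈ Set.uIcc 2 x, 2 ≤ t := by
    intro t ht; rw [Set.uIcc_of_le hx] at ht; exact ht.1
  rw [key, ← intervalIntegral.integral_comp_mul_deriv' (f := fun t => t ^ δ)
    (f' := fun t => δ * t ^ (δ - 1)) (g := fun t => 1 / Real.log t)]
  · apply intervalIntegral.integral_congr
    intro t ht
    have h2 := hpos t ht
    have hl : Real.log t ≠ 0 := (Real.log_pos (by linarith)).ne'
    simp only [Function.comp]
    rw [Real.log_rpow (by linarith)]
    field_simp
  · intro t ht
    exact Real.hasDerivAt_rpow_const (Or.inl (by linarith [hpos t ht]))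
  · intro t ht
    exact ((Real.continuousAt_rpow_const _ _ (Or.inl (by linarith [hpos t ht]))).const_mul
      δ).continuousWithinAt
  · rintro _ ⟨t, ht, rfl⟩
    have h2 := hpos t ht
    have hp : 0 < t ^ δ := by positivity
    have : Real.log (t ^ δ) ≠ 0 := by
      rw [Real.log_rpow (by linarith)]
      exact mul_ne_zero hδ (Real.log_pos (by linarith)).ne'
    exact (continuousAt_const.div (Real.continuousAt_log hp.ne') this).continuousWithinAt

lemma step_integral {f f' : ℝ → ℝ} {x u : ℝ} (hx : 2 ≤ x) (hu : u ≤ x)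
    (hd : ∀ t, 2 ≤ t → HasDerivAt f (f' t) t) (hc : ContinuousOn f' (Set.Ici 2)) :
    IntervalIntegrable (fun t => f' t * (if u ≤ t then 1 else 0)) volume 2 x ∧
    ∫ t in (2:ℝ)..x, f' t * (if u ≤ t then 1 else 0) = f x - f (max u 2) := by
  have e : (fun t => f' t * (if u ≤ t then 1 else 0)) = (Set.Ici u).indicator f' := by
    ext t; simp [Set.indicator_apply]
  have hi : ∀ a, 2 ≤ a → a ≤ x → IntervalIntegrable f' volume a x := by
    intro a ha hax
    apply ContinuousOn.intervalIntegrable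
    apply hc.mono
    rw [Set.uIcc_of_le hax]
    exact fun t ht => ha.trans ht.1
  have hftc : ∀ a, 2 ≤ a → a ≤ x → ∫ t in a..x, f' t = f x - f a := by
    intro a ha hax
    apply intervalIntegral.integral_eq_sub_of_hasDerivAt _ (hi a ha hax)
    intro t ht
    rw [Set.uIcc_of_le hax] at ht
    exact hd t (ha.trans ht.1)
  rw [e]
  constructor
  · have := hi 2 le_rfl hx
    rw [intervalIntegrable_iff] at this ⊢
    exact this.indicator measurableSet_Ici
  · rw [intervalIntegral.integral_of_le hx, setIntegral_indicator measurableSet_Ici]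
    rcases le_or_gt u 2 with h | h
    · have : Set.Ioc 2 x ∩ Set.Ici u = Set.Ioc 2 x := by
        ext t; simp only [Set.mem_inter_iff, Set.mem_Ioc, Set.mem_Ici]
        constructor
        · exact fun h => h.1
        · exact fun h' => ⟨h', by linarith⟩
      rw [this, ← intervalIntegral.integral_of_le hx, max_eq_right h]
      exact hftc 2 le_rfl hx
    · have : Set.Ioc 2 x ∩ Set.Ici u = Set.Icc u x := by
        ext t; simp only [Set.mem_inter_iff, Set.mem_Ioc, Set.mem_Ici, Set.mem_Icc]
        constructor
        · exact fun h => ⟨h.2, h.1.2⟩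
        · exact fun h' => ⟨⟨by linarith, h'.2⟩, h'.1⟩
      rw [this, integral_Icc_eq_integral_Ioc, ← intervalIntegral.integral_of_le hu,
        max_eq_left h.le]
      exact hftc u h.le hu

/-- Abel summation against a step function. -/
lemma abel_sum {P : Type} (Q : P → Prop) (u w : P → ℝ)
    (hfin : ∀ x : ℝ, {p | Q p ∧ u p ≤ x}.Finite) [∀ x, DecidablePred fun p => Q p ∧ u p ≤ x]
    {f f' : ℝ → ℝ}
    (hd : ∀ t, 2 ≤ t → HasDerivAt f (f' t) t) (hc : ContinuousOn f' (Set.Ici 2)) :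
    ∃ C : ℝ, ∀ x, 2 ≤ x →
      IntervalIntegrable (fun t => f' t * ∑' p, if Q p ∧ u p ≤ t then w p else 0) volume 2 x ∧
      (∑' p, if Q p ∧ u p ≤ x then w p * f (u p) else 0) =
        C + f x * (∑' p, if Q p ∧ u p ≤ x then w p else 0)
          - ∫ t in (2:ℝ)..x, f' t * ∑' p, if Q p ∧ u p ≤ t then w p else 0 := by
  classical
  have hts : ∀ (x t : ℝ) (g : P → ℝ), t ≤ x → (∑' p, if Q p ∧ u p ≤ t then g p else 0) =
      ∑ p ∈ (hfin x).toFinset, g p * (if u p ≤ t then 1 else 0) := by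
    intro x t g htx
    rw [tsum_eq_sum (s := (hfin x).toFinset)]
    · apply Finset.sum_congr rfl
      intro p hp
      have : Q p ∧ u p ≤ x := by simpa using hp
      simp [this.1]
    · intro p hp
      rw [if_neg]
      intro h
      exact hp (by simpa using ⟨h.1, h.2.trans htx⟩)
  refine ⟨∑ p ∈ (hfin 2).toFinset, w p * (f (u p) - f (max (u p) 2)), fun x hx => ?_⟩
  have hcongr : Set.EqOn
      (fun t => ∑ p ∈ (hfin x).toFinset, w p * (f' t * (if u p ≤ t then 1 else 0)))
      (fun t => f' t * ∑' p, if Q p ∧ u p ≤ t then w p else 0) (Set.uIcc 2 x) := by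
    intro t ht
    rw [Set.uIcc_of_le hx] at ht
    simp only
    rw [hts x t w ht.2, Finset.mul_sum]
    exact Finset.sum_congr rfl fun p _ => by ring
  have hmem : ∀ p ∈ (hfin x).toFinset, u p ≤ x := by
    intro p hp
    have : Q p ∧ u p ≤ x := by simpa using hp
    exact this.2
  have hI : ∀ p ∈ (hfin x).toFinset, IntervalIntegrable
      (fun t => w p * (f' t * (if u p ≤ t then 1 else 0))) volume 2 x :=
    fun p hp => (step_integral hx (hmem p hp) hd hc).1.const_mul _
  constructor
  · have h := IntervalIntegrable.sum _ hI
    have h2 : IntervalIntegrable (fun t => ∑ p ∈ (hfin x).toFinset,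
        w p * (f' t * (if u p ≤ t then 1 else 0))) volume 2 x := by
      have e : (fun t => ∑ p ∈ (hfin x).toFinset,
          w p * (f' t * (if u p ≤ t then 1 else 0))) = ∑ p ∈ (hfin x).toFinset,
          fun t => w p * (f' t * (if u p ≤ t then 1 else 0)) := by
        ext t; simp only [Finset.sum_apply]
      rw [e]; exact h
    exact h2.congr (hcongr.mono Set.uIoc_subset_uIcc)
  · rw [← intervalIntegral.integral_congr hcongr, intervalIntegral.integral_finsetSum hI,
      hts x x _ le_rfl, hts x x w le_rfl, Finset.mul_sum]
    have hsub : (hfin 2).toFinset ⊆ (hfin x).toFinset := by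
      intro p hp
      have : Q p ∧ u p ≤ 2 := by simpa using hp
      simpa using ⟨this.1, this.2.trans hx⟩
    rw [Finset.sum_subset hsub, ← Finset.sum_add_distrib, ← Finset.sum_sub_distrib]
    · apply Finset.sum_congr rfl
      intro p hp
      rw [intervalIntegral.integral_const_mul, (step_integral hx (hmem p hp) hd hc).2,
        if_pos (hmem p hp)]
      ring
    · intro p hp hp2
      have h1 : Q p ∧ u p ≤ x := by simpa using hp
      have h2 : ¬ (Q p ∧ u p ≤ 2) := by simpa using hp2
      have h3 : 2 ≤ u p := by
        by_contra h; exact h2 ⟨h1.1, by linarith⟩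
      rw [max_eq_left h3]; ring

lemma step_measurable {P : Type} [Countable P] (Q : P → Prop) (u w : P → ℝ)
    (hfin : ∀ x : ℝ, {p | Q p ∧ u p ≤ x}.Finite) [∀ x, DecidablePred fun p => Q p ∧ u p ≤ x] :
    Measurable (fun x : ℝ => ∑' p, if Q p ∧ u p ≤ x then w p else 0) := by
  refine measurable_of_tendsto_metrizable' (atTop : Filter (Finset P))
    (f := fun F x => ∑ p ∈ F, if Q p ∧ u p ≤ x then w p else 0) ?_ ?_
  · intro F
    refine Finset.measurable_sum _ fun p _ => ?_
    refine Measurable.ite ?_ measurable_const measurable_const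
    exact (MeasurableSet.const (Q p)).inter measurableSet_Ici
  · rw [tendsto_pi_nhds]
    intro x
    have : Summable (fun p => if Q p ∧ u p ≤ x then w p else 0) := by
      apply summable_of_finite_support
      apply (hfin x).subset
      intro p hp
      by_contra h
      exact hp (if_neg h)
    exact this.hasSum

lemma kernel_deriv (s : ℝ) (t : ℝ) (ht : 2 ≤ t) :
    HasDerivAt (fun t : ℝ => t ^ (-s) / Real.log t)
      (-(s / Real.log t + 1 / Real.log t ^ 2) * t ^ (-s - 1)) t := by
  have h0 : t ≠ 0 := by linarith
  have hl : Real.log t ≠ 0 := (Real.log_pos (by linarith)).ne'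
  have := (Real.hasDerivAt_rpow_const (p := -s) (Or.inl h0)).div (Real.hasDerivAt_log h0) hl
  refine HasDerivAt.congr_deriv this ?_
  rw [Real.rpow_sub_one h0]
  field_simp
  ring

lemma kernel_cont (s : ℝ) :
    ContinuousOn (fun t : ℝ => -(s / Real.log t + 1 / Real.log t ^ 2) * t ^ (-s - 1))
      (Set.Ici 2) := by
  intro t ht
  have ht' : 2 ≤ t := ht
  have h0 : t ≠ 0 := by linarith
  have hl : Real.log t ≠ 0 := (Real.log_pos (by linarith)).ne'
  apply ContinuousAt.continuousWithinAt
  have hc := Real.continuousAt_log h0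
  exact (((continuousAt_const.div hc hl).add
    (continuousAt_const.div (hc.pow 2) (pow_ne_zero 2 hl))).neg).mul
    (Real.continuousAt_rpow_const _ _ (Or.inl h0))

lemma main_term (s r x : ℝ) (hr : r ≠ 0) (hsr : s ≠ r) (hx : 2 ≤ x) :
    IntervalIntegrable (fun t : ℝ => -(s / Real.log t + 1 / Real.log t ^ 2) * t ^ (-s - 1)
      * (t ^ r / r)) volume 2 x ∧
    x ^ (-s) / Real.log x * (x ^ r / r)
      - (∫ t in (2:ℝ)..x, -(s / Real.log t + 1 / Real.log t ^ 2) * t ^ (-s - 1) * (t ^ r / r))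
      - Li (x ^ (r - s)) = (2:ℝ) ^ (-s) / Real.log 2 * (2 ^ r / r) - Li (2 ^ (r - s)) := by
  have hpos : ∀ t ∈ Set.uIcc 2 x, 2 ≤ t := by
    intro t ht; rw [Set.uIcc_of_le hx] at ht; exact ht.1
  have i1 : IntervalIntegrable (fun t : ℝ => -(s / Real.log t + 1 / Real.log t ^ 2) * t ^ (-s - 1)
      * (t ^ r / r)) volume 2 x := by
    apply ContinuousOn.intervalIntegrable
    refine ((kernel_cont s).mono fun t ht => hpos t ht).mul ?_
    intro t ht
    exact ((Real.continuousAt_rpow_const _ _ (Or.inl (by linarith [hpos t ht]))).div_const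
      r).continuousWithinAt
  have i2 : IntervalIntegrable (fun t : ℝ => t ^ (r - s - 1) / Real.log t) volume 2 x := by
    apply ContinuousOn.intervalIntegrable
    intro t ht
    have h2 := hpos t ht
    exact ((Real.continuousAt_rpow_const _ _ (Or.inl (by linarith))).div
      (Real.continuousAt_log (by linarith)) (Real.log_pos (by linarith)).ne').continuousWithinAt
  refine ⟨i1, ?_⟩
  have hL := Li_rpow (δ := r - s) (sub_ne_zero.2 hsr.symm) hx
  have hF := intervalIntegral.integral_eq_sub_of_hasDerivAt
    (f := fun t : ℝ => t ^ (-s) / Real.log t * (t ^ r / r)) (a := 2) (b := x)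
    (f' := fun t => -(s / Real.log t + 1 / Real.log t ^ 2) * t ^ (-s - 1) * (t ^ r / r)
      + t ^ (r - s - 1) / Real.log t) (by
      intro t ht
      have h2 := hpos t ht
      have h0 : t ≠ 0 := by linarith
      have := (kernel_deriv s t h2).mul
        ((Real.hasDerivAt_rpow_const (p := r) (Or.inl h0)).div_const r)
      refine HasDerivAt.congr_deriv this ?_
      have e : t ^ (r - s - 1) = t ^ (-s) * t ^ (r - 1) := by
        rw [← Real.rpow_add (by linarith)]; ring_nf
      rw [e]
      field_simp) (i1.add i2)
  rw [intervalIntegral.integral_add i1 i2] at hF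
  linarith

lemma bound_integrable (α β s : ℝ) (h : α < s) :
    IntegrableOn (fun t : ℝ => t ^ (α - s - 1) * Real.log t ^ β) (Set.Ioi 2) := by
  have : IntegrableOn (fun t : ℝ => t ^ (α - s - 1) * Real.log t ^ β) (Set.Ici 2) := by
    refine LocallyIntegrableOn.integrableOn_of_isBigO_atTop
      (g := fun t : ℝ => t ^ (-1 - (s - α) / 2)) ?_ ?_ ?_
    · apply ContinuousOn.locallyIntegrableOn _ measurableSet_Ici
      intro t ht
      have h2 : 2 ≤ t := ht
      exact ((Real.continuousAt_rpow_const _ _ (Or.inl (by linarith))).mul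
        ((Real.continuousAt_log (by linarith)).rpow_const
          (Or.inl (Real.log_pos (by linarith)).ne'))).continuousWithinAt
    · have h1 := (isLittleO_log_rpow_rpow_atTop (s := (s - α) / 2) β (by linarith)).isBigO
      have h2 := (Asymptotics.isBigO_refl (fun t : ℝ => t ^ (α - s - 1)) atTop).mul h1
      refine h2.congr' EventuallyEq.rfl ?_
      filter_upwards [eventually_gt_atTop 0] with t ht
      rw [← Real.rpow_add ht]; congr 1; ring
    · rw [integrableAtFilter_rpow_atTop_iff]; linarith
  exact this.mono_set Set.Ioi_subset_Ici_self

/-- **From the prime geodesic theorem to convergence of the renormalized log Euler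
product (direction 2 ⟹ 1 of Theorem 4.5).** If
`Ψ(x) = ∑_{N n ^ k ≤ x} a(n,k) log N n = ∑_j x^{s_j}/s_j + E(x)` with finitely many
`s_j ∈ (1/2, 1]` and `E(x) ≪ x^α (log x)^β`, `1/2 ≤ α < min_j s_j`, then for real `s > α`
with `s ≠ s_j`, the integral `∫_2^∞ E(t) t^{−s−1} dt` converges absolutely and
`lim_{x→∞} [∑_{N n ^ k ≤ x} a(n,k) N n^{−ks}/k − ∑_j Li(x^{s_j − s})]` exists. -/
theorem pgt_implies_renormalized_convergence
    {ι : Type} [Fintype ι] (sj : ι → ℝ) (hsj : ∀ j, sj j ∈ Set.Ioc (1/2 : ℝ) 1)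
    (N : ℕ → ℝ) (hN : ∀ n, 1 < N n)
    (hfin : ∀ x : ℝ, {p : ℕ × ℕ | 1 ≤ p.2 ∧ N p.1 ^ p.2 ≤ x}.Finite)
    (a : ℕ → ℕ → ℝ) (Ψ E : ℝ → ℝ)
    (hΨ : ∀ x : ℝ, Ψ x = ∑' p : ℕ × ℕ,
      if 1 ≤ p.2 ∧ N p.1 ^ p.2 ≤ x then a p.1 p.2 * Real.log (N p.1) else 0)
    (hE : ∀ x : ℝ, E x = Ψ x - ∑ j : ι, x ^ (sj j) / (sj j))
    (α β c : ℝ) (hα : 1/2 ≤ α) (hαj : ∀ j, α < sj j)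
    (hEbound : ∀ x : ℝ, 2 ≤ x → |E x| ≤ c * x ^ α * (Real.log x) ^ β) :
    ∀ s : ℝ, α < s → (∀ j, s ≠ sj j) →
      IntegrableOn (fun t : ℝ => E t * t ^ (-s - 1)) (Set.Ioi 2)
      ∧ ∃ l : ℝ, Tendsto
          (fun x : ℝ =>
            (∑' p : ℕ × ℕ, if 1 ≤ p.2 ∧ N p.1 ^ p.2 ≤ x then
              a p.1 p.2 / (p.2 * N p.1 ^ ((p.2 : ℝ) * s)) else 0)
            - ∑ j : ι, Li (x ^ (sj j - s)))
          atTop (nhds l) := by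
  intro s hs hsne
  have hQfin : ∀ x : ℝ, {p : ℕ × ℕ | 1 ≤ p.2 ∧ (fun p : ℕ × ℕ => N p.1 ^ p.2) p ≤ x}.Finite := hfin
  have hmΨ : Measurable Ψ := by
    have := step_measurable (fun p : ℕ × ℕ => 1 ≤ p.2) (fun p => N p.1 ^ p.2)
      (fun p => a p.1 p.2 * Real.log (N p.1)) hfin
    rwa [← funext hΨ] at this
  have hmE : Measurable E := by
    have e : E = fun x => Ψ x - ∑ j : ι, x ^ (sj j) / (sj j) := funext hE
    rw [e]
    fun_prop
  have hInt : IntegrableOn (fun t : ℝ => E t * t ^ (-s - 1)) (Set.Ioi 2) := by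
    refine Integrable.mono' ((bound_integrable α β s hs).const_mul c)
      (by apply Measurable.aestronglyMeasurable; fun_prop) ?_
    refine (ae_restrict_iff' measurableSet_Ioi).2 (Eventually.of_forall fun t ht => ?_)
    have h2 : 2 < t := ht
    have hp : 0 < t ^ (-s - 1) := by positivity
    rw [norm_mul, Real.norm_eq_abs, Real.norm_eq_abs, abs_of_pos hp]
    have := mul_le_mul_of_nonneg_right (hEbound t h2.le) hp.le
    refine this.trans (le_of_eq ?_)
    have e : t ^ (α - s - 1) = t ^ α * t ^ (-s - 1) := by
      rw [← Real.rpow_add (by linarith)]; ring_nf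
    rw [e]; ring
  refine ⟨hInt, ?_⟩
  set f : ℝ → ℝ := fun t => t ^ (-s) / Real.log t with hf
  set f' : ℝ → ℝ := fun t => -(s / Real.log t + 1 / Real.log t ^ 2) * t ^ (-s - 1) with hf'
  have hInt2 : IntegrableOn (fun t => f' t * E t) (Set.Ioi 2) := by
    have := Integrable.bdd_mul (f := fun t : ℝ => -(s / Real.log t + 1 / Real.log t ^ 2))
      (c := s / Real.log 2 + 1 / Real.log 2 ^ 2) hInt
      (by apply Measurable.aestronglyMeasurable; fun_prop) (by
        refine (ae_restrict_iff' measurableSet_Ioi).2 (Eventually.of_forall fun t ht => ?_)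
        have h2 : 2 < t := ht
        have hl2 : 0 < Real.log 2 := Real.log_pos (by norm_num)
        have hl : Real.log 2 ≤ Real.log t := Real.log_le_log (by norm_num) h2.le
        have hlt : 0 < Real.log t := by linarith
        have hs0 : 0 ≤ s := by linarith
        rw [norm_neg, Real.norm_eq_abs, abs_of_nonneg (by positivity)]
        gcongr)
    refine this.congr (Eventually.of_forall fun t => ?_)
    simp only [hf']; ring
  have hlim1 := intervalIntegral_tendsto_integral_Ioi 2 hInt2 tendsto_id
  have hlim2 : Tendsto (fun x => f x * E x) atTop (nhds 0) := by
    have h1 := (isLittleO_log_rpow_rpow_atTop (s := s - α) (β - 1) (by linarith)).tendsto_div_nhds_zero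
    have h2 := h1.const_mul c
    rw [mul_zero] at h2
    refine squeeze_zero_norm' ?_ h2
    filter_upwards [eventually_ge_atTop 2] with x hx
    have hlx : 0 < Real.log x := Real.log_pos (by linarith)
    have hx0 : 0 < x := by linarith
    have hp : 0 < f x := by simp only [hf]; positivity
    rw [norm_mul, Real.norm_eq_abs, Real.norm_eq_abs, abs_of_pos hp]
    refine (mul_le_mul_of_nonneg_left (hEbound x hx) hp.le).trans (le_of_eq ?_)
    simp only [hf]
    rw [Real.rpow_sub_one hlx.ne', Real.rpow_sub hx0, Real.rpow_neg hx0.le]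
    field_simp
  obtain ⟨C, hC⟩ := abel_sum (fun p : ℕ × ℕ => 1 ≤ p.2) (fun p => N p.1 ^ p.2)
      (fun p => a p.1 p.2 * Real.log (N p.1)) hfin (f := f) (f' := f')
      (kernel_deriv s) (kernel_cont s)
  simp only [← hΨ] at hC
  refine ⟨_, Tendsto.congr' ?_ (((hlim2.sub hlim1).const_add C).add_const
    (∑ j : ι, ((2:ℝ) ^ (-s) / Real.log 2 * (2 ^ sj j / sj j) - Li (2 ^ (sj j - s)))))⟩
  filter_upwards [eventually_ge_atTop 2] with x hx
  obtain ⟨hCi, hCx⟩ := hC x hx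
  have hsum : (∑' p : ℕ × ℕ, if 1 ≤ p.2 ∧ N p.1 ^ p.2 ≤ x then
      a p.1 p.2 / (p.2 * N p.1 ^ ((p.2 : ℝ) * s)) else 0) =
      ∑' p : ℕ × ℕ, if 1 ≤ p.2 ∧ N p.1 ^ p.2 ≤ x then
        a p.1 p.2 * Real.log (N p.1) * f (N p.1 ^ p.2) else 0 := by
    apply tsum_congr
    rintro ⟨n, k⟩
    by_cases h : 1 ≤ k ∧ N n ^ k ≤ x
    · simp only [h, if_true, and_self, hf]
      have hn := hN n
      have hl : 0 < Real.log (N n) := Real.log_pos hn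
      have hk : (0:ℝ) < k := by exact_mod_cast h.1
      have hn0 : 0 < N n := by linarith
      rw [Real.log_pow, ← Real.rpow_natCast (N n) k, ← Real.rpow_mul hn0.le, mul_neg,
        Real.rpow_neg hn0.le]
      have : 0 < N n ^ ((k:ℝ) * s) := by positivity
      field_simp
    · simp only [h, if_false]
  have hmt := fun j => main_term s (sj j) x (by linarith [(hsj j).1]) (hsne j) hx
  have hIE : ∫ t in (2:ℝ)..x, f' t * E t = (∫ t in (2:ℝ)..x, f' t * Ψ t)
      - ∑ j : ι, ∫ t in (2:ℝ)..x, f' t * (t ^ sj j / sj j) := by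
    rw [← intervalIntegral.integral_finsetSum (fun j _ => (hmt j).1),
      ← intervalIntegral.integral_sub hCi]
    · apply intervalIntegral.integral_congr
      intro t _
      simp only [hE, mul_sub, Finset.mul_sum, hf']
    · have := IntervalIntegrable.sum Finset.univ (fun j _ => (hmt j).1)
      have e : (fun t : ℝ => ∑ j : ι, -(s / Real.log t + 1 / Real.log t ^ 2) * t ^ (-s - 1)
          * (t ^ sj j / sj j)) = ∑ j : ι, fun t : ℝ =>
          -(s / Real.log t + 1 / Real.log t ^ 2) * t ^ (-s - 1) * (t ^ sj j / sj j) := by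
        ext t; simp only [Finset.sum_apply]
      rw [e]; exact this
  rw [hsum, hCx]
  simp only [id]
  rw [hIE, hE x, ← Finset.sum_congr rfl (fun j _ => (hmt j).2)]
  simp only [Finset.sum_sub_distrib, mul_sub, Finset.mul_sum]
  simp only [hf, hf']
  ring
end
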